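/- Unconditional energy stability of the first-order IEQ scheme: let ε ∈ ℝ, δt > 0, B ∈ ℝ, let F : ℝ → ℝ be continuously differentiable with F(s) + B > 0 for all s, set H(s) = F'(s)/√(F(s)+B), and let M : ℝ → ℝ be continuously differentiable with M(s) ≥ 0 for all s. Suppose φⁿ, φ^{n+1}, μ, Uⁿ, U^{n+1} : ℝᵈ → ℝ are smooth ℤᵈ-periodic functions satisfying, pointwise on ℝᵈ: (φ^{n+1} − φⁿ)/δt = div(M(φⁿ)∇μ), μ = −ε²Δφ^{n+1} + U^{n+1}·H(φⁿ), and 2(U^{n+1} − Uⁿ) = H(φⁿ)(φ^{n+1} − φⁿ). Then, with E(φ,U) = ∫_Q (ε²/2 |∇φ(x)|² + U(x)²) dx − B, one has (1/δt)(E(φ^{n+1},U^{n+1}) − E(φⁿ,Uⁿ)) ≤ −∫_Q M(φⁿ(x)) |∇μ(x)|² dx ≤ 0. -/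

import Mathlib

open MeasureTheory Real

noncomputable section

/-- `ℝᵈ` as a Euclidean space. -/
abbrev Esp (d : ℕ) := EuclideanSpace ℝ (Fin d)

/-- The unit cell `Q = [0,1]^d`. -/
def unitCube (d : ℕ) : Set (Esp d) := {x | ∀ i, 0 ≤ x i ∧ x i ≤ 1}

/-- `ℤᵈ`-periodicity of a (scalar- or vector-valued) function on `ℝᵈ`. -/
def ZPer {d : ℕ} {α : Type*} (g : Esp d → α) : Prop :=
  ∀ (x : Esp d) (k : Fin d → ℤ),
    g (x + (WithLp.equiv 2 (Fin d → ℝ)).symm (fun i => (k i : ℝ))) = g x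

/-- Divergence of a vector field on `ℝᵈ`. -/
def pdiv {d : ℕ} (F : Esp d → Esp d) (x : Esp d) : ℝ :=
  ∑ i, fderiv ℝ (fun y => F y i) x (EuclideanSpace.single i 1)

/-- Laplacian of a scalar field on `ℝᵈ`. -/
def plap {d : ℕ} (f : Esp d → ℝ) (x : Esp d) : ℝ := pdiv (gradient f) x
lemma unitCube_eq_preimage_Icc (d : ℕ) :
    unitCube d = WithLp.ofLp ⁻¹' (Set.Icc (0 : Fin d → ℝ) 1) := by
  ext x
  simp [unitCube, Pi.le_def, forall_and]

lemma isCompact_unitCube (d : ℕ) : IsCompact (unitCube d) := by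
  rw [unitCube_eq_preimage_Icc]
  exact (PiLp.continuousLinearEquiv 2 ℝ (fun _ : Fin d => ℝ)).toHomeomorph.isCompact_preimage.2
    isCompact_Icc

lemma integrableOn_unitCube {d : ℕ} {f : Esp d → ℝ} (hf : Continuous f) :
    IntegrableOn f (unitCube d) :=
  hf.continuousOn.integrableOn_compact (isCompact_unitCube d)

lemma contDiff_coord {d : ℕ} {n : WithTop ℕ∞} {V : Esp d → Esp d} (hV : ContDiff ℝ n V)
    (i : Fin d) : ContDiff ℝ n fun y => V y i :=
  (contDiff_piLp 2).1 hV i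

lemma continuous_pdiv {d : ℕ} {V : Esp d → Esp d} (hV : ContDiff ℝ 1 V) :
    Continuous (pdiv V) := by
  unfold pdiv
  refine continuous_finsetSum _ fun i _ => ?_
  exact ((contDiff_coord hV i).continuous_fderiv one_ne_zero).clm_apply continuous_const

/-- The divergence of a periodic `C¹` vector field has zero integral over the unit cell. -/
lemma integral_pdiv_eq_zero {d : ℕ} (hd : 1 ≤ d) {V : Esp d → Esp d} (hV : ContDiff ℝ 1 V)
    (hp : ZPer V) : ∫ x in unitCube d, pdiv V x = 0 := by
  obtain ⟨n, rfl⟩ := Nat.exists_eq_add_of_le' hd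
  have hpull : ∫ x in unitCube (n + 1), pdiv V x
      = ∫ y in Set.Icc (0 : Fin (n + 1) → ℝ) 1, pdiv V (WithLp.toLp 2 y) := by
    rw [unitCube_eq_preimage_Icc]
    exact (PiLp.volume_preserving_ofLp (Fin (n + 1))).setIntegral_preimage_emb
      (MeasurableEquiv.toLp 2 (Fin (n + 1) → ℝ)).symm.measurableEmbedding
      (fun y => pdiv V (WithLp.toLp 2 y)) _
  let L : (Fin (n + 1) → ℝ) →L[ℝ] Esp (n + 1) :=
    (PiLp.continuousLinearEquiv 2 ℝ (fun _ : Fin (n + 1) => ℝ)).symm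
  have hdiv : ∀ y : Fin (n + 1) → ℝ, pdiv V (WithLp.toLp 2 y)
      = ∑ i, ((fderiv ℝ (fun z => V z i) (L y)).comp L) (Pi.single i 1) := fun y => rfl
  have hcont : ∀ i, Continuous fun y => V (L y) i := fun i =>
    (contDiff_coord hV i).continuous.comp L.continuous
  rw [hpull]
  simp only [hdiv]
  rw [integral_divergence_of_hasFDerivAt_off_countable' 0 1 zero_le_one
    (fun i y => V (L y) i) (fun i y => (fderiv ℝ (fun z => V z i) (L y)).comp L) ∅
    Set.countable_empty (fun i => (hcont i).continuousOn)
    (fun y _ i => (((contDiff_coord hV i).differentiable one_ne_zero) (L y)).hasFDerivAt.comp y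
      L.hasFDerivAt) ?_]
  · refine Finset.sum_eq_zero fun i _ => sub_eq_zero.2 ?_
    refine integral_congr_ae (Filter.Eventually.of_forall fun y => ?_)
    have hshift : L (i.insertNth (1 : ℝ) y) = L (i.insertNth (0 : ℝ) y) +
        (WithLp.equiv 2 (Fin (n + 1) → ℝ)).symm
          (fun j => ((Pi.single i 1 : Fin (n + 1) → ℤ) j : ℝ)) := by
      ext j
      change i.insertNth (α := fun _ => ℝ) (1 : ℝ) y j
        = i.insertNth (α := fun _ => ℝ) (0 : ℝ) y j + ((Pi.single i 1 : Fin (n + 1) → ℤ) j : ℝ)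
      refine Fin.succAboveCases i ?_ (fun k => ?_) j <;> simp
    change V (L (i.insertNth (1 : ℝ) y)) i = V (L (i.insertNth (0 : ℝ) y)) i
    rw [hshift, hp]
  · have : Continuous fun y : Fin (n + 1) → ℝ => pdiv V (L y) :=
      (continuous_pdiv hV).comp L.continuous
    exact this.continuousOn.integrableOn_compact isCompact_Icc

lemma contDiff_gradient {d : ℕ} {f : Esp d → ℝ} (hf : ContDiff ℝ (⊤ : ℕ∞) f) :
    ContDiff ℝ 1 (gradient f) :=
  (InnerProductSpace.toDual ℝ (Esp d)).symm.contDiff.comp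
    (hf.fderiv_right (m := 1) (by norm_cast))

lemma ZPer.gradient {d : ℕ} {f : Esp d → ℝ} (hf : ZPer f) : ZPer (gradient f) := by
  intro x k
  have h := fderiv_comp_add_right (𝕜 := ℝ) (f := f) (x := x)
    ((WithLp.equiv 2 (Fin d → ℝ)).symm (fun i => (k i : ℝ)))
  rw [funext fun y => hf y k] at h
  simp only [_root_.gradient, h]

lemma pdiv_add {d : ℕ} {V W : Esp d → Esp d} (hV : ContDiff ℝ 1 V) (hW : ContDiff ℝ 1 W)
    (x : Esp d) : pdiv (fun y => V y + W y) x = pdiv V x + pdiv W x := by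
  simp only [pdiv, ← Finset.sum_add_distrib]
  refine Finset.sum_congr rfl fun i _ => ?_
  have h := fderiv_fun_add ((contDiff_coord hV i).differentiable one_ne_zero x)
    ((contDiff_coord hW i).differentiable one_ne_zero x)
  simp only [PiLp.add_apply, h, add_apply]

lemma pdiv_smul {d : ℕ} {f : Esp d → ℝ} {V : Esp d → Esp d} (hf : ContDiff ℝ 1 f)
    (hV : ContDiff ℝ 1 V) (x : Esp d) :
    pdiv (fun y => f y • V y) x = f x * pdiv V x + inner ℝ (gradient f x) (V x) := by
  have hcoord : ∀ i, inner ℝ (gradient f x) (EuclideanSpace.single i (1 : ℝ))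
      = fderiv ℝ f x (EuclideanSpace.single i 1) := fun i => inner_gradient_left
  have hinner : inner ℝ (gradient f x) (V x)
      = ∑ i, V x i * fderiv ℝ f x (EuclideanSpace.single i 1) := by
    rw [PiLp.inner_apply]
    refine Finset.sum_congr rfl fun i _ => ?_
    rw [← hcoord i, EuclideanSpace.inner_single_right]
    simp
  rw [hinner, pdiv, pdiv, Finset.mul_sum, ← Finset.sum_add_distrib]
  refine Finset.sum_congr rfl fun i _ => ?_
  have h := fderiv_fun_mul (hf.differentiable one_ne_zero x)
    ((contDiff_coord hV i).differentiable one_ne_zero x)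
  simp only [PiLp.smul_apply, smul_eq_mul, h, add_apply,
    smul_apply]

lemma gradient_sub {d : ℕ} {f g : Esp d → ℝ} {x : Esp d} (hf : DifferentiableAt ℝ f x)
    (hg : DifferentiableAt ℝ g x) :
    gradient (fun y => f y - g y) x = gradient f x - gradient g x := by
  simp only [gradient, fderiv_fun_sub hf hg, map_sub]

lemma gradient_const_mul {d : ℕ} {f : Esp d → ℝ} {x : Esp d} (hf : DifferentiableAt ℝ f x)
    (c : ℝ) : gradient (fun y => c * f y) x = c • gradient f x := by
  simp only [gradient, fderiv_const_mul hf c, map_smulₛₗ, conj_trivial]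

/-- Unconditional energy stability of the first-order IEQ scheme:
`(1/δt)(E(φ^{n+1},U^{n+1}) − E(φⁿ,Uⁿ)) ≤ −∫_Q M(φⁿ)|∇μ|² ≤ 0`. -/
theorem first_order_ieq_energy_stability (d : ℕ) (hd : 1 ≤ d)
    (ε δt B : ℝ) (hδt : 0 < δt)
    (F : ℝ → ℝ) (hF : ContDiff ℝ 1 F) (hFB : ∀ s : ℝ, 0 < F s + B)
    (H : ℝ → ℝ) (hH : ∀ s : ℝ, H s = deriv F s / Real.sqrt (F s + B))
    (M : ℝ → ℝ) (hM : ContDiff ℝ 1 M) (hM0 : ∀ s : ℝ, 0 ≤ M s)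
    (φ0 φ1 μ U0 U1 : Esp d → ℝ)
    (hφ0 : ContDiff ℝ (⊤ : ℕ∞) φ0) (hφ1 : ContDiff ℝ (⊤ : ℕ∞) φ1) (hμ : ContDiff ℝ (⊤ : ℕ∞) μ)
    (hU0 : ContDiff ℝ (⊤ : ℕ∞) U0) (hU1 : ContDiff ℝ (⊤ : ℕ∞) U1)
    (hpφ0 : ZPer φ0) (hpφ1 : ZPer φ1) (hpμ : ZPer μ)
    (hpU0 : ZPer U0) (hpU1 : ZPer U1)
    (heq1 : ∀ x : Esp d,
      (φ1 x - φ0 x) / δt = pdiv (fun y => M (φ0 y) • gradient μ y) x)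
    (heq2 : ∀ x : Esp d, μ x = -ε ^ 2 * plap φ1 x + U1 x * H (φ0 x))
    (heq3 : ∀ x : Esp d, 2 * (U1 x - U0 x) = H (φ0 x) * (φ1 x - φ0 x))
    (E : (Esp d → ℝ) → (Esp d → ℝ) → ℝ)
    (hE : ∀ φ U : Esp d → ℝ, E φ U =
      (∫ x in unitCube d, (ε ^ 2 / 2 * ‖gradient φ x‖ ^ 2 + (U x) ^ 2)) - B) :
    (1 / δt) * (E φ1 U1 - E φ0 U0)
        ≤ -∫ x in unitCube d, M (φ0 x) * ‖gradient μ x‖ ^ 2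
      ∧ (-∫ x in unitCube d, M (φ0 x) * ‖gradient μ x‖ ^ 2) ≤ 0 := by
  have h1 : ((1 : ℕ∞) : WithTop ℕ∞) ≤ ((⊤ : ℕ∞) : WithTop ℕ∞) := by exact_mod_cast le_top
  have cφ0 : ContDiff ℝ 1 φ0 := hφ0.of_le h1
  have cφ1 : ContDiff ℝ 1 φ1 := hφ1.of_le h1
  have cμ : ContDiff ℝ 1 μ := hμ.of_le h1
  have gφ0 := contDiff_gradient hφ0
  have gφ1 := contDiff_gradient hφ1
  have gμ := contDiff_gradient hμ
  have cw : ContDiff ℝ 1 fun y => ε ^ 2 * (φ1 y - φ0 y) := contDiff_const.mul (cφ1.sub cφ0)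
  have cδμ : ContDiff ℝ 1 fun y => δt * μ y := contDiff_const.mul cμ
  have cJ : ContDiff ℝ 1 fun y => M (φ0 y) • gradient μ y := (hM.comp cφ0).smul gμ
  let V : Esp d → Esp d := fun y => (ε ^ 2 * (φ1 y - φ0 y)) • gradient φ1 y
    + (δt * μ y) • (M (φ0 y) • gradient μ y)
  have cV : ContDiff ℝ 1 V := (cw.smul gφ1).add (cδμ.smul cJ)
  have pV : ZPer V := by
    intro x k
    simp only [V, hpφ0 x k, hpφ1 x k, hpμ x k, hpφ1.gradient x k, hpμ.gradient x k]
  have hpt : ∀ x, (ε ^ 2 / 2 * ‖gradient φ1 x‖ ^ 2 + (U1 x) ^ 2)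
      - (ε ^ 2 / 2 * ‖gradient φ0 x‖ ^ 2 + (U0 x) ^ 2)
      ≤ pdiv V x - δt * (M (φ0 x) * ‖gradient μ x‖ ^ 2) := by
    intro x
    have dφ0 := cφ0.differentiable one_ne_zero x
    have dφ1 := cφ1.differentiable one_ne_zero x
    have dμ := cμ.differentiable one_ne_zero x
    have hV : pdiv V x = ε ^ 2 * (φ1 x - φ0 x) * plap φ1 x
        + ε ^ 2 * (‖gradient φ1 x‖ ^ 2 - inner ℝ (gradient φ0 x) (gradient φ1 x))
        + (μ x * (φ1 x - φ0 x) + δt * (M (φ0 x) * ‖gradient μ x‖ ^ 2)) := by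
      rw [show pdiv V x = _ from pdiv_add
          (V := fun y => (ε ^ 2 * (φ1 y - φ0 y)) • gradient φ1 y)
          (W := fun y => (δt * μ y) • (M (φ0 y) • gradient μ y))
          (cw.smul gφ1) (cδμ.smul cJ) x,
        pdiv_smul cw gφ1, pdiv_smul cδμ cJ, ← heq1, gradient_const_mul (dφ1.fun_sub dφ0),
        gradient_sub dφ1 dφ0, gradient_const_mul dμ, real_inner_smul_left, inner_sub_left,
        real_inner_smul_left, real_inner_smul_right, real_inner_self_eq_norm_sq,
        real_inner_self_eq_norm_sq, plap]
      field_simp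
    have hsq : 0 ≤ ‖gradient φ1 x‖ ^ 2 - 2 * inner ℝ (gradient φ0 x) (gradient φ1 x)
        + ‖gradient φ0 x‖ ^ 2 := by
      have h := norm_sub_sq_real (gradient φ1 x) (gradient φ0 x)
      rw [real_inner_comm] at h
      rw [← h]
      positivity
    have hμw : μ x * (φ1 x - φ0 x) = -ε ^ 2 * plap φ1 x * (φ1 x - φ0 x)
        + U1 x * (2 * (U1 x - U0 x)) := by
      rw [heq3, heq2]
      ring
    rw [hV, hμw]
    nlinarith [mul_nonneg (sq_nonneg ε) hsq, sq_nonneg (U1 x - U0 x)]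
  have iE : ∀ {φ U : Esp d → ℝ}, ContDiff ℝ 1 (gradient φ) → ContDiff ℝ (⊤ : ℕ∞) U →
      IntegrableOn (fun x => ε ^ 2 / 2 * ‖gradient φ x‖ ^ 2 + (U x) ^ 2) (unitCube d) :=
    fun hφ hU => integrableOn_unitCube
      ((continuous_const.mul (hφ.continuous.norm.pow 2)).add (hU.continuous.pow 2))
  have iM : IntegrableOn (fun x => M (φ0 x) * ‖gradient μ x‖ ^ 2) (unitCube d) :=
    integrableOn_unitCube
      ((hM.continuous.comp hφ0.continuous).mul (gμ.continuous.norm.pow 2))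
  have iV : IntegrableOn (pdiv V) (unitCube d) := integrableOn_unitCube (continuous_pdiv cV)
  have hint := integral_mono ((iE gφ1 hU1).sub (iE gφ0 hU0)) (iV.sub (iM.const_mul δt)) hpt
  simp only [Pi.sub_apply] at hint
  rw [integral_sub (iE gφ1 hU1) (iE gφ0 hU0), integral_sub iV (iM.const_mul δt),
    integral_pdiv_eq_zero hd cV pV, integral_const_mul] at hint
  constructor
  · rw [hE, hE, one_div, inv_mul_le_iff₀ hδt]
    linarith
  · exact neg_nonpos.2 (integral_nonneg fun x => mul_nonneg (hM0 _) (sq_nonneg _))
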